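/- For every τ in the upper half-plane ℍ, ε₂(−1/τ) = τ⁴ ε₁(τ), where ε₁(τ) = (1/16)θ₂(0,τ)⁴θ₃(0,τ)⁴ and ε₂(τ) = (1/16)θ₁(0,τ)⁴θ₃(0,τ)⁴. -/

import Mathlib

open Complex

noncomputable section

/-- `q^s = e^{2πisτ}`. -/
def qpow (s τ : ℂ) : ℂ := Complex.exp (2 * (Real.pi : ℂ) * Complex.I * s * τ)

/-- The Jacobi theta function `θ(v, τ)`, defined by its infinite product. -/
def jTheta (v τ : ℂ) : ℂ :=
  2 * qpow (1/8) τ * Complex.sin ((Real.pi : ℂ) * v) *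
    ∏' j : ℕ, ((1 - qpow ((j : ℂ) + 1) τ)
      * (1 - Complex.exp (2 * (Real.pi : ℂ) * Complex.I * v) * qpow ((j : ℂ) + 1) τ)
      * (1 - Complex.exp (-(2 * (Real.pi : ℂ) * Complex.I * v)) * qpow ((j : ℂ) + 1) τ))

/-- The Jacobi theta function `θ₁(v, τ)`, defined by its infinite product. -/
def jTheta1 (v τ : ℂ) : ℂ :=
  2 * qpow (1/8) τ * Complex.cos ((Real.pi : ℂ) * v) *
    ∏' j : ℕ, ((1 - qpow ((j : ℂ) + 1) τ)
      * (1 + Complex.exp (2 * (Real.pi : ℂ) * Complex.I * v) * qpow ((j : ℂ) + 1) τ)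
      * (1 + Complex.exp (-(2 * (Real.pi : ℂ) * Complex.I * v)) * qpow ((j : ℂ) + 1) τ))

/-- The Jacobi theta function `θ₂(v, τ)`, defined by its infinite product
(the `j`-th factor involves `q^{j+1-1/2}`). -/
def jTheta2 (v τ : ℂ) : ℂ :=
  ∏' j : ℕ, ((1 - qpow ((j : ℂ) + 1) τ)
    * (1 - Complex.exp (2 * (Real.pi : ℂ) * Complex.I * v) * qpow ((j : ℂ) + 1/2) τ)
    * (1 - Complex.exp (-(2 * (Real.pi : ℂ) * Complex.I * v)) * qpow ((j : ℂ) + 1/2) τ))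

/-- The Jacobi theta function `θ₃(v, τ)`, defined by its infinite product. -/
def jTheta3 (v τ : ℂ) : ℂ :=
  ∏' j : ℕ, ((1 - qpow ((j : ℂ) + 1) τ)
    * (1 + Complex.exp (2 * (Real.pi : ℂ) * Complex.I * v) * qpow ((j : ℂ) + 1/2) τ)
    * (1 + Complex.exp (-(2 * (Real.pi : ℂ) * Complex.I * v)) * qpow ((j : ℂ) + 1/2) τ))

/-- `θ'(0, τ)`: the partial derivative of `θ(v, τ)` in `v`, evaluated at `v = 0`. -/
def jThetaDeriv (τ : ℂ) : ℂ := deriv (fun v => jTheta v τ) 0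

/-- `ε₁(τ) = (1/16)θ₂(0,τ)⁴θ₃(0,τ)⁴`. -/
def epsilon1 (τ : ℂ) : ℂ := (1/16) * (jTheta2 0 τ ^ 4 * jTheta3 0 τ ^ 4)

/-- `ε₂(τ) = (1/16)θ₁(0,τ)⁴θ₃(0,τ)⁴`. -/
def epsilon2 (τ : ℂ) : ℂ := (1/16) * (jTheta1 0 τ ^ 4 * jTheta3 0 τ ^ 4)

/-- The Euler product `∏ (1 - q ^ (n + 1))`. -/
def eulerProd (q : ℂ) : ℂ := ∏' n : ℕ, (1 - q ^ (n + 1))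

lemma norm_sq_lt_one {q : ℂ} (hq : ‖q‖ < 1) : ‖q ^ 2‖ < 1 := by
  rw [norm_pow]
  exact pow_lt_one₀ (norm_nonneg _) hq two_ne_zero

lemma multipliable_one_add_pow {q : ℂ} (hq : ‖q‖ < 1) :
    Multipliable fun n : ℕ ↦ 1 + q ^ (n + 1) := by
  apply multipliable_one_add_of_summable
  simpa using (summable_nat_add_iff 1).mpr (summable_geometric_of_lt_one (norm_nonneg _) hq)

lemma summable_norm_pow_odd {q : ℂ} (hq : ‖q‖ < 1) :
    Summable fun n : ℕ ↦ ‖q ^ (2 * n + 1)‖ := by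
  have h : Summable fun n : ℕ ↦ ‖q ^ n‖ := by
    simpa using summable_geometric_of_lt_one (norm_nonneg _) hq
  exact h.comp_injective (i := fun n : ℕ ↦ 2 * n + 1) fun a b hab ↦ by simpa using hab

lemma multipliable_one_add_pow_odd {q : ℂ} (hq : ‖q‖ < 1) :
    Multipliable fun n : ℕ ↦ 1 + q ^ (2 * n + 1) :=
  multipliable_one_add_of_summable (summable_norm_pow_odd hq)

lemma multipliable_one_sub_pow_odd {q : ℂ} (hq : ‖q‖ < 1) :
    Multipliable fun n : ℕ ↦ 1 - q ^ (2 * n + 1) := by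
  simpa [sub_eq_add_neg] using multipliable_one_add_of_summable (f := fun n ↦ -q ^ (2 * n + 1))
    (by simpa using summable_norm_pow_odd hq)

lemma tprod_one_sub_pow_odd_mul {q : ℂ} (hq : ‖q‖ < 1) :
    (∏' n : ℕ, (1 - q ^ (2 * n + 1))) * eulerProd (q ^ 2) = eulerProd q := by
  have h := tprod_even_mul_odd (f := fun n : ℕ ↦ 1 - q ^ (n + 1))
    (multipliable_one_sub_pow_odd hq)
    (by simpa [← pow_mul, mul_add] using!
      ModularForm.multipliable_one_sub_pow (norm_sq_lt_one hq))
  simpa [eulerProd, ← pow_mul, mul_add] using! h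

lemma tprod_one_add_pow_odd_mul {q : ℂ} (hq : ‖q‖ < 1) :
    (∏' n : ℕ, (1 + q ^ (2 * n + 1))) * ∏' n : ℕ, (1 + (q ^ 2) ^ (n + 1)) =
      ∏' n : ℕ, (1 + q ^ (n + 1)) := by
  have h := tprod_even_mul_odd (f := fun n : ℕ ↦ 1 + q ^ (n + 1))
    (multipliable_one_add_pow_odd hq)
    (by simpa [← pow_mul, mul_add] using! multipliable_one_add_pow (norm_sq_lt_one hq))
  simpa [← pow_mul, mul_add] using! h

lemma tprod_one_add_pow_mul {q : ℂ} (hq : ‖q‖ < 1) :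
    (∏' n : ℕ, (1 + q ^ (n + 1))) * eulerProd q = eulerProd (q ^ 2) := by
  rw [eulerProd, ← (multipliable_one_add_pow hq).tprod_mul
    (ModularForm.multipliable_one_sub_pow hq), eulerProd]
  exact tprod_congr fun n ↦ by ring

lemma tprod_one_sub_mul_one_add_pow_odd {q : ℂ} (hq : ‖q‖ < 1) :
    (∏' n : ℕ, (1 - q ^ (2 * n + 1))) * ∏' n : ℕ, (1 + q ^ (2 * n + 1)) =
      ∏' n : ℕ, (1 - (q ^ 2) ^ (2 * n + 1)) := by
  rw [← (multipliable_one_sub_pow_odd hq).tprod_mul (multipliable_one_add_pow_odd hq)]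
  exact tprod_congr fun n ↦ by ring

lemma norm_exp_pi_I_mul_lt_one {τ : ℂ} (hτ : 0 < τ.im) : ‖exp (Real.pi * I * τ)‖ < 1 := by
  rw [norm_exp, Real.exp_lt_one_iff]
  simpa using mul_pos Real.pi_pos hτ

lemma qpow_nat_add_one (n : ℕ) (τ : ℂ) :
    qpow (n + 1) τ = (exp (Real.pi * I * τ) ^ 2) ^ (n + 1) := by
  rw [qpow, ← exp_nat_mul, ← exp_nat_mul]
  push_cast
  ring_nf

lemma qpow_nat_add_half (n : ℕ) (τ : ℂ) :
    qpow (n + 1 / 2) τ = exp (Real.pi * I * τ) ^ (2 * n + 1) := by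
  rw [qpow, ← exp_nat_mul]
  push_cast
  ring_nf

lemma tprod_mul_mul_self {f g : ℕ → ℂ} (hf : Multipliable f) (hg : Multipliable g) :
    ∏' n, (f n * g n * g n) = (∏' n, f n) * (∏' n, g n) ^ 2 := by
  rw [(hf.mul hg).tprod_mul hg, hf.tprod_mul hg]
  ring

lemma jTheta1_zero {τ p : ℂ} (hτ : 0 < τ.im) (hp : p = exp (Real.pi * I * τ)) :
    jTheta1 0 τ = 2 * qpow (1 / 8) τ *
      (eulerProd (p ^ 2) * (∏' n : ℕ, (1 + (p ^ 2) ^ (n + 1))) ^ 2) := by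
  have hq : ‖p ^ 2‖ < 1 := norm_sq_lt_one (hp ▸ norm_exp_pi_I_mul_lt_one hτ)
  rw [eulerProd, ← tprod_mul_mul_self (ModularForm.multipliable_one_sub_pow hq)
    (multipliable_one_add_pow hq)]
  simp [jTheta1, qpow_nat_add_one, hp]

lemma jTheta2_zero {τ p : ℂ} (hτ : 0 < τ.im) (hp : p = exp (Real.pi * I * τ)) :
    jTheta2 0 τ = eulerProd (p ^ 2) * (∏' n : ℕ, (1 - p ^ (2 * n + 1))) ^ 2 := by
  have hp1 : ‖p‖ < 1 := hp ▸ norm_exp_pi_I_mul_lt_one hτ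
  rw [eulerProd, ← tprod_mul_mul_self (ModularForm.multipliable_one_sub_pow (norm_sq_lt_one hp1))
    (multipliable_one_sub_pow_odd hp1)]
  simp only [jTheta2, qpow_nat_add_one, qpow_nat_add_half, hp]
  simp

lemma jTheta3_zero {τ p : ℂ} (hτ : 0 < τ.im) (hp : p = exp (Real.pi * I * τ)) :
    jTheta3 0 τ = eulerProd (p ^ 2) * (∏' n : ℕ, (1 + p ^ (2 * n + 1))) ^ 2 := by
  have hp1 : ‖p‖ < 1 := hp ▸ norm_exp_pi_I_mul_lt_one hτ
  rw [eulerProd, ← tprod_mul_mul_self (ModularForm.multipliable_one_sub_pow (norm_sq_lt_one hp1))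
    (multipliable_one_add_pow_odd hp1)]
  simp only [jTheta3, qpow_nat_add_one, qpow_nat_add_half, hp]
  simp

lemma eta_eq_qpow_mul_eulerProd (τ : ℂ) :
    ModularForm.eta τ = qpow (1 / 24) τ * eulerProd (exp (2 * Real.pi * I * τ)) := by
  simp only [ModularForm.eta, ModularForm.eta_q_eq_pow, eulerProd, qpow,
    Function.Periodic.qParam]
  congr 2
  push_cast
  ring

lemma epsilon1_mul_eta {τ : ℂ} (hτ : 0 < τ.im) :
    16 * epsilon1 τ * ModularForm.eta (2 * τ) ^ 8 = ModularForm.eta τ ^ 16 := by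
  obtain ⟨p, hp⟩ : ∃ p, p = exp (Real.pi * I * τ) := ⟨_, rfl⟩
  have hp1 : ‖p‖ < 1 := hp ▸ norm_exp_pi_I_mul_lt_one hτ
  have h1 : exp (2 * Real.pi * I * τ) = p ^ 2 := by
    rw [hp, ← exp_nat_mul]; push_cast; ring_nf
  have h2 : exp (2 * Real.pi * I * (2 * τ)) = (p ^ 2) ^ 2 := by
    rw [← h1, ← exp_nat_mul]; push_cast; ring_nf
  have h3 : qpow (1 / 24) (2 * τ) ^ 8 = qpow (1 / 24) τ ^ 16 := by
    rw [qpow, qpow, ← exp_nat_mul, ← exp_nat_mul]; push_cast; ring_nf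
  rw [epsilon1, jTheta2_zero hτ hp, jTheta3_zero hτ hp, eta_eq_qpow_mul_eulerProd,
    eta_eq_qpow_mul_eulerProd, h1, h2, mul_pow (qpow _ _), mul_pow (qpow _ _), h3,
    ← tprod_one_sub_pow_odd_mul (norm_sq_lt_one hp1), ← tprod_one_sub_mul_one_add_pow_odd hp1]
  ring

lemma epsilon2_mul_eta {τ : ℂ} (hτ : 0 < τ.im) :
    epsilon2 τ * ModularForm.eta (τ / 2) ^ 8 = ModularForm.eta τ ^ 16 := by
  obtain ⟨p, hp⟩ : ∃ p, p = exp (Real.pi * I * τ) := ⟨_, rfl⟩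
  have hp1 : ‖p‖ < 1 := hp ▸ norm_exp_pi_I_mul_lt_one hτ
  have h1 : exp (2 * Real.pi * I * τ) = p ^ 2 := by
    rw [hp, ← exp_nat_mul]; push_cast; ring_nf
  have h2 : exp (2 * Real.pi * I * (τ / 2)) = p := by
    rw [hp]; ring_nf
  have h3 : qpow (1 / 8) τ ^ 4 * qpow (1 / 24) (τ / 2) ^ 8 = qpow (1 / 24) τ ^ 16 := by
    simp only [qpow]
    rw [← exp_nat_mul, ← exp_nat_mul, ← exp_nat_mul, ← exp_add]; push_cast; ring_nf
  have h4 := tprod_one_add_pow_mul hp1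
  rw [← tprod_one_add_pow_odd_mul hp1] at h4
  rw [epsilon2, jTheta1_zero hτ hp, jTheta3_zero hτ hp, eta_eq_qpow_mul_eulerProd,
    eta_eq_qpow_mul_eulerProd, h1, h2, mul_pow (qpow _ _) _ 16, ← h3]
  generalize (∏' n : ℕ, (1 + p ^ (2 * n + 1))) = a at *
  generalize (∏' n : ℕ, (1 + (p ^ 2) ^ (n + 1))) = b at *
  rw [← h4]
  ring

lemma sqrt_pow_eight (z : ℂ) (hz : z ≠ 0) : z.sqrt ^ 8 = z ^ 4 := by
  rw [sqrt_eq_exp hz, ← exp_nat_mul]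
  nth_rw 2 [← exp_log hz]
  rw [← exp_nat_mul]
  push_cast
  ring_nf

lemma eta_neg_one_div_pow_eight {τ : ℂ} (hτ : 0 < τ.im) :
    ModularForm.eta (-1 / τ) ^ 8 = τ ^ 4 * ModularForm.eta τ ^ 8 := by
  have h : ModularForm.eta (-1 / τ) = I.sqrt⁻¹ * (τ.sqrt * ModularForm.eta τ) := by
    simpa using ModularForm.eta_comp_eq_csqrt_I_inv hτ
  have hne : τ ≠ 0 := by rintro rfl; simp at hτ
  rw [h, mul_pow, mul_pow, inv_pow, sqrt_pow_eight I I_ne_zero, sqrt_pow_eight τ hne]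
  simp

/-- The transformation law `ε₂(-1/τ) = τ⁴ ε₁(τ)` for every `τ` in the upper half-plane. -/
theorem epsilon2_S_transformation (τ : ℂ) (hτ : 0 < τ.im) :
    epsilon2 (-1 / τ) = τ ^ 4 * epsilon1 τ := by
  have hne : τ ≠ 0 := by rintro rfl; simp at hτ
  have hτ2 : 0 < (2 * τ).im := by simpa using hτ
  have hσ : 0 < (-1 / τ).im := by
    simpa [neg_div] using UpperHalfPlane.im_inv_neg_coe_pos ⟨τ, hτ⟩
  have h1 := epsilon1_mul_eta hτ
  have h2 := epsilon2_mul_eta hσ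
  have h3 : -1 / τ / 2 = -1 / (2 * τ) := by field_simp
  rw [h3, eta_neg_one_div_pow_eight hτ2, pow_mul _ 8 2, eta_neg_one_div_pow_eight hτ] at h2
  have hη : ModularForm.eta (2 * τ) ≠ 0 := ModularForm.eta_ne_zero hτ2
  have hc : 16 * τ ^ 4 * ModularForm.eta (2 * τ) ^ 8 ≠ 0 :=
    mul_ne_zero (mul_ne_zero (by norm_num) (pow_ne_zero _ hne)) (pow_ne_zero _ hη)
  apply mul_right_cancel₀ hc
  linear_combination h2 - τ ^ 8 * h1
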